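/- For any λ>0 and any edge e of G, the function f(e,x)=|V(T_λ(x))|, regarded as a function of t(x) for points x on e, is a piecewise constant function with O(n) breakpoints. -/

import Mathlib

namespace KCenter

/-- A connected undirected graph network: each vertex `v` has a positive weight `w v`
and each edge `{u,v}` has a positive length `len u v`. -/
structure Net (V : Type) [Fintype V] [DecidableEq V] where
  G : SimpleGraph V
  conn : G.Connected
  w : V → ℝ
  w_pos : ∀ v, 0 < w v
  len : V → V → ℝ
  len_symm : ∀ u v, len u v = len v u
  len_pos : ∀ u v, G.Adj u v → 0 < len u v

variable {V : Type} [Fintype V] [DecidableEq V]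

/-- The length of a walk: the sum of the lengths of its edges. -/
noncomputable def wlen (N : Net V) {u v : V} (p : N.G.Walk u v) : ℝ :=
  (p.edges.map (Sym2.lift ⟨N.len, N.len_symm⟩)).sum

/-- The shortest-path distance between two vertices. -/
noncomputable def dV (N : Net V) (u v : V) : ℝ :=
  sInf {r : ℝ | ∃ p : N.G.Walk u v, wlen N p = r}

/-- A point of the graph: it lies on the edge `e(u,v)` at distance `t` from `u`
(with `0 ≤ t ≤ len u v`). -/
structure Pt (N : Net V) where
  u : V
  v : V
  adj : N.G.Adj u v
  t : ℝ
  ht0 : 0 ≤ t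
  ht1 : t ≤ N.len u v

/-- The length of the edge a point lies on. -/
noncomputable def elen {N : Net V} (x : Pt N) : ℝ := N.len x.u x.v

/-- The shortest-path distance from a point to a vertex. -/
noncomputable def dP (N : Net V) (x : Pt N) (a : V) : ℝ :=
  min (x.t + dV N x.u a) ((elen x - x.t) + dV N x.v a)

/-- `par` encodes a shortest path tree of the point `x`, rooted at the (possibly dummy)
vertex containing `x`: `par a = none` means `a` is attached directly to `x` along the edge
containing `x`, and `par a = some b` means `b` is the tree parent of `a`; in both cases the
tree path from `x` to `a` is a shortest path. -/
def IsSPT (N : Net V) (x : Pt N) (par : V → Option V) : Prop :=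
  ∀ a : V,
    (par a = none →
      (a = x.u ∧ dP N x a = x.t) ∨ (a = x.v ∧ dP N x a = elen x - x.t)) ∧
    (∀ b : V, par a = some b → N.G.Adj b a ∧ dP N x b + N.len b a = dP N x a)

/-- Adjacency in the shortest path tree encoded by `par` (among real vertices). -/
def tAdj (par : V → Option V) (a b : V) : Prop := par a = some b ∨ par b = some a

/-- A set `S` of vertices is connected under the relation `r` using only vertices of `S`. -/
def ConnIn (r : V → V → Prop) (S : Set V) : Prop :=
  ∀ a ∈ S, ∀ b ∈ S, Relation.ReflTransGen (fun p q => q ∈ S ∧ r p q) a b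

/-- `S` is (the vertex set of) a `k`-subtree of a shortest path tree of `x`,
i.e. `S` has `k` vertices and is connected inside some shortest path tree of `x`. -/
def IsKSub (N : Net V) (k : ℕ) (x : Pt N) (S : Set V) : Prop :=
  S.ncard = k ∧ ∃ par : V → Option V, IsSPT N x par ∧ ConnIn (tAdj par) S

/-- `max_{v ∈ S} w v * d(x,v)`. -/
noncomputable def mval (N : Net V) (x : Pt N) (S : Set V) : ℝ :=
  sSup {y : ℝ | ∃ v ∈ S, y = N.w v * dP N x v}

/-- The set of objective values `max_{v∈T^k} w_v d(x,v)` over all points `x` of `G` and all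
`k`-subtrees `T^k` of shortest path trees of `x`; its least element is `λ* = min_x φ(x,G)`. -/
def vals (N : Net V) (k : ℕ) : Set ℝ :=
  {y : ℝ | ∃ (x : Pt N) (S : Set V), IsKSub N k x S ∧ y = mval N x S}

/-- The point `x` is a point of the subtree with vertex set `S`:
it is located at a vertex of `S`, or interior of an edge with both endpoints in `S`. -/
def PtOn (N : Net V) (x : Pt N) (S : Set V) : Prop :=
  (x.t = 0 ∧ x.u ∈ S) ∨ (x.t = elen x ∧ x.v ∈ S) ∨
  (0 < x.t ∧ x.t < elen x ∧ x.u ∈ S ∧ x.v ∈ S)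

/-- `a` is a neutral vertex of `x` (equivalently, `x` is the semicircular point of `a` on
the edge containing `x`). -/
def Neutral (N : Net V) (x : Pt N) (a : V) : Prop :=
  dV N a x.u + x.t = dV N a x.v + (elen x - x.t)

/-- `V_r(x)`: vertices strictly on the `x.u`-side of `x`. -/
def Vr (N : Net V) (x : Pt N) : Set V :=
  {a | dV N a x.u + x.t < dV N a x.v + (elen x - x.t)}

/-- `V_s(x)`: vertices strictly on the `x.v`-side of `x`. -/
def Vs (N : Net V) (x : Pt N) : Set V :=
  {a | dV N a x.v + (elen x - x.t) < dV N a x.u + x.t}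

/-- `V̄(x)`: the set of neutral vertices of `x`. -/
def NbarSet (N : Net V) (x : Pt N) : Set V := {a | Neutral N x a}

/-- `Λ`: the local one-center objective values; for an edge `e(r,s)` and two distinct
vertices `u ≠ v`, the value of an intersection of the increasing branch of `D(u,·)`
with the decreasing branch of `D(v,·)` at a point of `e(r,s)`. -/
def Lam1 (N : Net V) : Set ℝ :=
  {y : ℝ | ∃ r s : V, N.G.Adj r s ∧ ∃ u v : V, u ≠ v ∧ ∃ t : ℝ,
    0 ≤ t ∧ t ≤ N.len r s ∧
    dV N u r + t ≤ dV N u s + (N.len r s - t) ∧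
    dV N v s + (N.len r s - t) ≤ dV N v r + t ∧
    N.w u * (dV N u r + t) = y ∧ N.w v * (dV N v s + (N.len r s - t)) = y}

/-- `Λ'`: the values `w_v · d(v, x')` over all vertices `v` and all semicircular points `x'`
(of any vertex `u`) on edges of `G`. -/
def Lam2 (N : Net V) : Set ℝ :=
  {y : ℝ | ∃ v u r s : V, N.G.Adj r s ∧ ∃ t : ℝ,
    0 ≤ t ∧ t ≤ N.len r s ∧
    dV N u r + t = dV N u s + (N.len r s - t) ∧
    y = N.w v * min (t + dV N r v) ((N.len r s - t) + dV N s v)}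

/-- `S` is (the vertex set of) a `k`-subtree of `G`. -/
def KSubG (N : Net V) (k : ℕ) (S : Set V) : Prop :=
  S.ncard = k ∧ ConnIn N.G.Adj S

/-- The weighted diameter `W(G') = max_{u,v∈V(G')} w_u w_v d(u,v)/(w_u+w_v)`. -/
noncomputable def Wd (N : Net V) (S : Set V) : ℝ :=
  sSup {y : ℝ | ∃ u ∈ S, ∃ v ∈ S, y = N.w u * N.w v * dV N u v / (N.w u + N.w v)}

/-- The subtree with vertex set `S` is covered by the point `x` under `lam`. -/
def Covered (N : Net V) (lam : ℝ) (x : Pt N) (S : Set V) : Prop :=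
  ∀ v ∈ S, N.w v * dP N x v ≤ lam

/-- The vertex `a` is the (real) vertex at which the point `x` is located. -/
def AtX (N : Net V) (x : Pt N) (a : V) : Prop :=
  (x.t = 0 ∧ a = x.u) ∨ (x.t = elen x ∧ a = x.v)

/-- `S` together with `x` induces a connected subtree of the shortest path tree `par` of `x`:
`S` is closed under tree parents, up to the root `x`. -/
def SelfIncl (N : Net V) (x : Pt N) (par : V → Option V) (S : Set V) : Prop :=
  ∀ a ∈ S, ∀ b : V, par a = some b → b ∈ S ∨ AtX N x b

/-- `S` is a covered self-inclusive subtree of `x` under `lam`. -/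
def CSI (N : Net V) (lam : ℝ) (x : Pt N) (S : Set V) : Prop :=
  ∃ par : V → Option V, IsSPT N x par ∧ SelfIncl N x par S ∧ Covered N lam x S

/-- `a` is a heavy vertex of `x`: it cannot be covered by `x` under `lam`. -/
def Heavy (N : Net V) (lam : ℝ) (x : Pt N) (a : V) : Prop := lam < N.w a * dP N x a

/-- The walk `p` (from `a` to an endpoint of the edge containing `x`), extended by the
corresponding segment to `x`, is a shortest path from `a` to `x`. -/
def ShortestToX (N : Net V) (x : Pt N) {a b : V} (p : N.G.Walk a b) : Prop :=
  (b = x.u ∧ wlen N p + x.t = dP N x a) ∨ (b = x.v ∧ wlen N p + (elen x - x.t) = dP N x a)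

/-- `a` is a descendant of the set `S` w.r.t. `x`: every shortest path from `a` to `x`
contains a vertex of `S`. -/
def DescOf (N : Net V) (x : Pt N) (S : Set V) (a : V) : Prop :=
  ∀ (b : V) (p : N.G.Walk a b), ShortestToX N x p → ∃ c ∈ p.support, c ∈ S

/-- `a` is a light vertex of `x`: it is neither heavy nor a descendant of the set of heavy
vertices of `x`. -/
def Light (N : Net V) (lam : ℝ) (x : Pt N) (a : V) : Prop :=
  ¬ Heavy N lam x a ∧ ¬ DescOf N x {c | Heavy N lam x c} a

/-- `f(e,x) = |V(T_λ(x))|`: the maximum cardinality of a covered self-inclusive subtree of `x`. -/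
noncomputable def fval (N : Net V) (lam : ℝ) (x : Pt N) : ℕ :=
  sSup {c : ℕ | ∃ S : Set V, CSI N lam x S ∧ S.ncard = c}

/-- `a` is light by `r = x.u` w.r.t. `x`: it has a shortest path to `x` through the segment
between `r` and `x` that contains no heavy vertex of `x`. -/
def LightByR (N : Net V) (lam : ℝ) (x : Pt N) (a : V) : Prop :=
  ∃ p : N.G.Walk a x.u, wlen N p + x.t = dP N x a ∧ ∀ c ∈ p.support, ¬ Heavy N lam x c

/-- `a` is light by `s = x.v` w.r.t. `x`. -/
def LightByS (N : Net V) (lam : ℝ) (x : Pt N) (a : V) : Prop :=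
  ∃ p : N.G.Walk a x.v, wlen N p + (elen x - x.t) = dP N x a ∧ ∀ c ∈ p.support, ¬ Heavy N lam x c

/-- `Q_r(x)`: the light-by-`r` vertices of `x` in `V_r(x)` together with the neutral vertices
of `x` that are light by `r`. -/
def Qr (N : Net V) (lam : ℝ) (x : Pt N) : Set V :=
  {a | dV N a x.u + x.t ≤ dV N a x.v + (elen x - x.t) ∧ LightByR N lam x a}

/-- `Q_s(x)`: the light-by-`s` vertices of `x` in `V_s(x)` together with the neutral vertices
of `x` that are light by `s`. -/
def Qs (N : Net V) (lam : ℝ) (x : Pt N) : Set V :=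
  {a | dV N a x.v + (elen x - x.t) ≤ dV N a x.u + x.t ∧ LightByS N lam x a}

/-- In a tree, the point `x` lies on the path from the vertex `v` to the vertex `root`. -/
def OnPathToRoot (N : Net V) (root v : V) (x : Pt N) : Prop :=
  dP N x v + dP N x root = dV N v root

/-- `x` is the critical point of the vertex `v` w.r.t. `root`: it lies on the path from `v`
to `root`; it satisfies `w_v · d(v,x) = λ` when this equation has a solution on the path
(i.e. when `λ ≤ w_v · d(v,root)`), and it is the root otherwise. -/
def CritPt (N : Net V) (lam : ℝ) (root v : V) (x : Pt N) : Prop :=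
  OnPathToRoot N root v x ∧
    ((lam ≤ N.w v * dV N v root ∧ N.w v * dP N x v = lam) ∨
     (N.w v * dV N v root < lam ∧ dP N x root = 0))


lemma wlen_nonneg (N : Net V) {u v : V} (p : N.G.Walk u v) : 0 ≤ wlen N p := by
  refine List.sum_nonneg fun y hy => ?_
  obtain ⟨e, he, rfl⟩ := List.mem_map.1 hy
  have hmem := p.edges_subset_edgeSet he
  induction e using Sym2.ind with
  | _ a b => exact (N.len_pos a b hmem).le

lemma dV_le_wlen (N : Net V) {u v : V} (p : N.G.Walk u v) : dV N u v ≤ wlen N p :=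
  csInf_le ⟨0, by rintro _ ⟨q, rfl⟩; exact wlen_nonneg N q⟩ ⟨p, rfl⟩

lemma dV_self_le (N : Net V) (u : V) : dV N u u ≤ 0 := by
  simpa [wlen] using dV_le_wlen N (SimpleGraph.Walk.nil : N.G.Walk u u)

lemma dV_le_add_len (N : Net V) (u : V) {a b : V} (h : N.G.Adj b a) :
    dV N u a ≤ dV N u b + N.len b a := by
  rw [← sub_le_iff_le_add]
  obtain ⟨q⟩ := N.conn.preconnected u b
  refine le_csInf ⟨_, q, rfl⟩ ?_
  rintro _ ⟨p, rfl⟩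
  have := dV_le_wlen N (p.concat h)
  simp only [wlen, SimpleGraph.Walk.edges_concat, List.concat_eq_append, List.map_append,
    List.map_cons, List.map_nil, List.sum_append, List.sum_singleton, Sym2.lift_mk] at this ⊢
  linarith

/-- The reals `t` and `t'` lie strictly on the same side of `b`. -/
def SameSide (b t t' : ℝ) : Prop := (t < b ∧ t' < b) ∨ (b < t ∧ b < t')

lemma SameSide.symm {b t t' : ℝ} (h : SameSide b t t') : SameSide b t' t :=
  h.imp And.symm And.symm

lemma sameSide_of_not_between {b t t' : ℝ} (htt : t ≤ t') (h : ¬ (t ≤ b ∧ b ≤ t')) :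
    SameSide b t t' := by
  rcases lt_or_ge b t with hb | hb
  · exact Or.inr ⟨hb, hb.trans_le htt⟩
  · have hb' : t' < b := lt_of_not_ge fun hb' => h ⟨hb, hb'⟩
    exact Or.inl ⟨htt.trans_lt hb', hb'⟩

/-- The parameter of the semicircular point of `a` on the edge `e(r,s)`. -/
noncomputable def semiT (N : Net V) (r s a : V) : ℝ := (N.len r s + dV N s a - dV N r a) / 2

/-- The parameter at which `a` is at distance `lam / w a` through `r`. -/
noncomputable def covR (N : Net V) (lam : ℝ) (r a : V) : ℝ := lam / N.w a - dV N r a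

/-- The parameter at which `a` is at distance `lam / w a` through `s`. -/
noncomputable def covS (N : Net V) (lam : ℝ) (r s a : V) : ℝ :=
  N.len r s + dV N s a - lam / N.w a

lemma dP_of_lt_semiT (N : Net V) {x : Pt N} {a : V} (h : x.t < semiT N x.u x.v a) :
    dP N x a = x.t + dV N x.u a := by
  unfold semiT at h
  exact min_eq_left (by unfold elen; linarith)

lemma dP_of_semiT_lt (N : Net V) {x : Pt N} {a : V} (h : semiT N x.u x.v a < x.t) :
    dP N x a = elen x - x.t + dV N x.v a := by
  unfold semiT at h
  exact min_eq_right (by unfold elen; linarith)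

section Transfer

variable {N : Net V} {r s : V} {h : N.G.Adj r s} {t t' : ℝ} {ht0 : 0 ≤ t}
  {ht1 : t ≤ N.len r s} {ht0' : 0 ≤ t'} {ht1' : t' ≤ N.len r s}

lemma IsSPT.transfer (hsemi : ∀ a, SameSide (semiT N r s a) t t') {par : V → Option V}
    (hpar : IsSPT N ⟨r, s, h, t, ht0, ht1⟩ par) : IsSPT N ⟨r, s, h, t', ht0', ht1'⟩ par := by
  have hlt {a : V} {τ : ℝ} {h0 : 0 ≤ τ} {h1 : τ ≤ N.len r s} (H : τ < semiT N r s a) :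
      dP N ⟨r, s, h, τ, h0, h1⟩ a = τ + dV N r a := dP_of_lt_semiT N H
  have hgt {a : V} {τ : ℝ} {h0 : 0 ≤ τ} {h1 : τ ≤ N.len r s} (H : semiT N r s a < τ) :
      dP N ⟨r, s, h, τ, h0, h1⟩ a = N.len r s - τ + dV N s a := dP_of_semiT_lt N H
  intro a
  obtain ⟨hnone, hsome⟩ := hpar a
  refine ⟨fun ha => ?_, fun b hb => ?_⟩
  · refine (hnone ha).imp ?_ ?_
    · rintro ⟨rfl, hd⟩
      refine ⟨rfl, ?_⟩
      have hself := dV_self_le N a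
      rcases hsemi a with ⟨h1, h2⟩ | ⟨h1, h2⟩
      · rw [hlt h1] at hd
        rw [hlt h2]
        dsimp only at hd ⊢
        linarith
      · rw [hgt h1] at hd
        unfold semiT at h1
        dsimp only at hd
        linarith
    · rintro ⟨rfl, hd⟩
      refine ⟨rfl, ?_⟩
      have hself := dV_self_le N a
      rcases hsemi a with ⟨h1, h2⟩ | ⟨h1, h2⟩
      · rw [hlt h1] at hd
        unfold semiT at h1
        dsimp only [elen] at hd
        linarith
      · rw [hgt h1] at hd
        rw [hgt h2]
        dsimp only [elen] at hd ⊢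
        linarith
  · obtain ⟨hadj, hd⟩ := hsome b hb
    refine ⟨hadj, ?_⟩
    have hr := dV_le_add_len N r hadj
    have hs := dV_le_add_len N s hadj
    rcases hsemi a with ⟨h1, h2⟩ | ⟨h1, h2⟩ <;> rcases hsemi b with ⟨h3, h4⟩ | ⟨h3, h4⟩
    · rw [hlt h1, hlt h3] at hd
      rw [hlt h2, hlt h4]
      linarith
    · rw [hlt h1, hgt h3] at hd
      unfold semiT at h1
      linarith
    · rw [hgt h1, hlt h3] at hd
      unfold semiT at h1
      linarith
    · rw [hgt h1, hgt h3] at hd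
      rw [hgt h2, hgt h4]
      linarith

lemma Covered.transfer {lam : ℝ} (hsemi : ∀ a, SameSide (semiT N r s a) t t')
    (hcovR : ∀ a, SameSide (covR N lam r a) t t')
    (hcovS : ∀ a, SameSide (covS N lam r s a) t t') {S : Set V}
    (hS : Covered N lam ⟨r, s, h, t, ht0, ht1⟩ S) :
    Covered N lam ⟨r, s, h, t', ht0', ht1'⟩ S := by
  intro a ha
  have hd := hS a ha
  rw [mul_comm, ← le_div_iff₀ (N.w_pos a)] at hd ⊢
  rcases hsemi a with ⟨h1, h2⟩ | ⟨h1, h2⟩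
  · rw [dP_of_lt_semiT N h1] at hd
    rw [dP_of_lt_semiT N h2]
    have := hcovR a
    unfold SameSide covR at this
    dsimp only at hd ⊢
    rcases this with ⟨_, _⟩ | ⟨_, _⟩ <;> linarith
  · rw [dP_of_semiT_lt N h1] at hd
    rw [dP_of_semiT_lt N h2]
    have := hcovS a
    unfold SameSide covS at this
    dsimp only [elen] at hd ⊢
    rcases this with ⟨_, _⟩ | ⟨_, _⟩ <;> linarith

lemma CSI.transfer {lam : ℝ} (hsemi : ∀ a, SameSide (semiT N r s a) t t')
    (hcovR : ∀ a, SameSide (covR N lam r a) t t')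
    (hcovS : ∀ a, SameSide (covS N lam r s a) t t')
    (hzero : SameSide 0 t t') (hlen : SameSide (N.len r s) t t') {S : Set V}
    (hS : CSI N lam ⟨r, s, h, t, ht0, ht1⟩ S) : CSI N lam ⟨r, s, h, t', ht0', ht1'⟩ S := by
  obtain ⟨par, hpar, hself, hcov⟩ := hS
  refine ⟨par, hpar.transfer hsemi, fun a ha b hb => (hself a ha b hb).imp_right ?_,
    hcov.transfer hsemi hcovR hcovS⟩
  rintro (⟨ht, -⟩ | ⟨ht, -⟩)
  · rcases hzero with h0 | h0
    · exact absurd ht h0.1.ne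
    · exact absurd ht h0.1.ne'
  · rcases hlen with h0 | h0
    · exact absurd ht h0.1.ne
    · exact absurd ht h0.1.ne'

end Transfer

/-- For any `λ > 0` and any edge `e` of `G`, the function
`f(e,x) = |V(T_λ(x))|`, regarded as a function of `t(x)` for points `x` on `e`, is a
piecewise constant function with `O(n)` breakpoints: there is an absolute constant `C`
such that on every `n`-vertex network there is a set of at most `C·n` breakpoints away
from which the function is constant. -/
theorem stmt12 :
    ∃ C : ℕ, ∀ (n : ℕ) (N : Net (Fin n)) (lam : ℝ), 0 < lam →
      ∀ (r s : Fin n) (h : N.G.Adj r s),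
        ∃ B : Finset ℝ, B.card ≤ C * n ∧
          ∀ (t t' : ℝ) (ht0 : 0 ≤ t) (htt : t ≤ t') (ht1 : t' ≤ N.len r s),
            (∀ b ∈ B, ¬ (t ≤ b ∧ b ≤ t')) →
            fval N lam ⟨r, s, h, t, ht0, htt.trans ht1⟩ =
              fval N lam ⟨r, s, h, t', ht0.trans htt, ht1⟩ := by
  refine ⟨5, fun n N lam _ r s h => ?_⟩
  classical
  refine ⟨Finset.univ.image (semiT N r s) ∪ Finset.univ.image (covR N lam r) ∪
    Finset.univ.image (covS N lam r s) ∪ {0, N.len r s}, ?_, ?_⟩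
  · have hcard (f : Fin n → ℝ) : (Finset.univ.image f).card ≤ n :=
      Finset.card_image_le.trans_eq (Finset.card_fin n)
    have hn : 0 < n := r.pos
    refine (Finset.card_union_le _ _).trans ?_
    have h1 := Finset.card_union_le
      (Finset.univ.image (semiT N r s) ∪ Finset.univ.image (covR N lam r))
      (Finset.univ.image (covS N lam r s))
    have h2 := Finset.card_union_le
      (Finset.univ.image (semiT N r s)) (Finset.univ.image (covR N lam r))
    have h3 := hcard (semiT N r s)
    have h4 := hcard (covR N lam r)
    have h5 := hcard (covS N lam r s)
    have h6 : ({0, N.len r s} : Finset ℝ).card ≤ 2 := Finset.card_le_two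
    omega
  · intro t t' ht0 htt ht1 hB
    have hside (b : ℝ) (hb : b ∈ Finset.univ.image (semiT N r s) ∪
        Finset.univ.image (covR N lam r) ∪ Finset.univ.image (covS N lam r s) ∪
        {0, N.len r s}) : SameSide b t t' :=
      sameSide_of_not_between htt (hB b hb)
    have hsemi (a : Fin n) : SameSide (semiT N r s a) t t' := hside _ (by simp)
    have hcovR (a : Fin n) : SameSide (covR N lam r a) t t' := hside _ (by simp)
    have hcovS (a : Fin n) : SameSide (covS N lam r s a) t t' := hside _ (by simp)
    have hzero : SameSide 0 t t' := hside _ (by simp)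
    have hlen : SameSide (N.len r s) t t' := hside _ (by simp)
    unfold fval
    congr 1
    ext c
    refine exists_congr fun S => and_congr_left fun _ => ⟨?_, ?_⟩
    · exact CSI.transfer hsemi hcovR hcovS hzero hlen
    · exact CSI.transfer (fun a => (hsemi a).symm) (fun a => (hcovR a).symm)
        (fun a => (hcovS a).symm) hzero.symm hlen.symm

end KCenter
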